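/- For every integer d there exist a plane graph G with outer face C, a vertex x ∈ V(C), and a list assignment L such that: |L(x)| = 1; |L(v)| = 3 for every vertex v not incident with C; 2 ≤ |L(v)| ≤ 3 for every v ∈ V(C) ∖ {x}; the vertices with lists of size two form an independent set; G contains exactly one cycle of length at most 4, and the distance from x to this cycle is at least d; and G is not L-colorable. (Thus the necessity of hypothesis (T) in Theorem 2 of the paper cannot be remedied by excluding any finite set of configurations near the precolored vertex.) -/

import Mathlib

open SimpleGraph

/-- A plane embedding (drawing without crossings) of a simple graph `G`:
vertices are mapped to distinct points of the plane, each edge to a simple arc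
joining the images of its endpoints, such that distinct edges meet only in
common endpoints and arcs pass through no other vertex images. -/
structure PlaneEmbedding {V : Type} (G : SimpleGraph V) : Type where
  pos : V → ℝ × ℝ
  pos_inj : Function.Injective pos
  arc : ∀ ⦃u v : V⦄, G.Adj u v → ℝ → ℝ × ℝ
  arc_continuousOn : ∀ ⦃u v : V⦄ (h : G.Adj u v), ContinuousOn (arc h) (Set.Icc 0 1)
  arc_injOn : ∀ ⦃u v : V⦄ (h : G.Adj u v), Set.InjOn (arc h) (Set.Icc 0 1)
  arc_zero : ∀ ⦃u v : V⦄ (h : G.Adj u v), arc h 0 = pos u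
  arc_one : ∀ ⦃u v : V⦄ (h : G.Adj u v), arc h 1 = pos v
  arc_symm : ∀ ⦃u v : V⦄ (h : G.Adj u v),
    arc h.symm '' Set.Icc 0 1 = arc h '' Set.Icc 0 1
  arc_inter : ∀ ⦃u v x y : V⦄ (h₁ : G.Adj u v) (h₂ : G.Adj x y),
    s(u, v) ≠ s(x, y) →
    (arc h₁ '' Set.Icc 0 1) ∩ (arc h₂ '' Set.Icc 0 1) ⊆ pos '' ({u, v} ∩ {x, y})
  arc_vertex : ∀ ⦃u v : V⦄ (h : G.Adj u v) (w : V),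
    pos w ∈ arc h '' Set.Icc 0 1 → w = u ∨ w = v

/-- The point set of the drawing: all vertex images and all edge arcs. -/
def PlaneEmbedding.drawing {V : Type} {G : SimpleGraph V}
    (emb : PlaneEmbedding G) : Set (ℝ × ℝ) :=
  Set.range emb.pos ∪ ⋃ (u : V) (v : V) (h : G.Adj u v), emb.arc h '' Set.Icc 0 1

/-- The outer (unbounded) face of a plane embedding: points not on the drawing
whose connected component in the complement of the drawing is unbounded. -/
def PlaneEmbedding.outerFace {V : Type} {G : SimpleGraph V}
    (emb : PlaneEmbedding G) : Set (ℝ × ℝ) :=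
  {p | p ∉ emb.drawing ∧ ¬ Bornology.IsBounded (connectedComponentIn emb.drawingᶜ p)}

/-- A vertex is incident with the outer face if its image lies on the closure of
the outer face. -/
def PlaneEmbedding.OuterVertex {V : Type} {G : SimpleGraph V}
    (emb : PlaneEmbedding G) (v : V) : Prop :=
  emb.pos v ∈ closure emb.outerFace

/-- `φ` is a proper `L`-coloring of `G`. -/
def IsLColoring {V : Type} (G : SimpleGraph V) (L : V → Finset ℕ) (φ : V → ℕ) : Prop :=
  (∀ v, φ v ∈ L v) ∧ ∀ ⦃u v : V⦄, G.Adj u v → φ u ≠ φ v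

/-- `G` is `L`-colorable. -/
def LColorable {V : Type} (G : SimpleGraph V) (L : V → Finset ℕ) : Prop :=
  ∃ φ, IsLColoring G L φ

/-- `G` is `k`-choosable. -/
def Choosable {V : Type} (G : SimpleGraph V) (k : ℕ) : Prop :=
  ∀ L : V → Finset ℕ, (∀ v, k ≤ (L v).card) → LColorable G L

/-- Any two distinct cycles of length at most `4` in `G` are at distance at least `d`:
for any two such cycles (distinct as subgraphs, i.e. with different edge sets), every
walk from a vertex of one to a vertex of the other has length at least `d`. -/
def CyclesFarApart {V : Type} [DecidableEq V] (G : SimpleGraph V) (d : ℕ) : Prop :=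
  ∀ ⦃a b : V⦄ (c₁ : G.Walk a a) (c₂ : G.Walk b b),
    c₁.IsCycle → c₂.IsCycle → c₁.length ≤ 4 → c₂.length ≤ 4 →
    c₁.edges.toFinset ≠ c₂.edges.toFinset →
    ∀ x ∈ c₁.support, ∀ y ∈ c₂.support, ∀ p : G.Walk x y, d ≤ p.length

/-- The lattice points of a strip of `n + 1` blocks. Column `0` and the columns congruent to `3`
modulo `4` hold a single point on the axis; every other column holds two points, at heights `±1`. -/
def IsSite (n : ℕ) (p : ℤ × ℤ) : Prop :=
  0 ≤ p.1 ∧ p.1 ≤ 4 * n + 3 ∧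
    ((p.1 = 0 ∨ p.1 % 4 = 3) ∧ p.2 = 0 ∨ p.1 ≠ 0 ∧ p.1 % 4 ≠ 3 ∧ (p.2 = 1 ∨ p.2 = -1))

/-- The vertices of the strip. -/
abbrev Site (n : ℕ) : Type := {p : ℤ × ℤ // IsSite n p}

namespace Site

variable {n : ℕ}

instance : Finite (Site n) := by
  refine Set.Finite.subset ((Set.finite_Icc (0 : ℤ) (4 * n + 3)).prod (Set.finite_Icc (-1 : ℤ) 1)) ?_
  rintro ⟨k, s⟩ ⟨h₀, h₁, h₂⟩
  simp only [Set.mem_prod, Set.mem_Icc] at *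
  omega

/-- The edges of the strip, each with one orientation: steps to the next column that do not cross
the axis, and vertical rungs in the columns congruent to `1` modulo `4`. -/
def Arrow (u v : Site n) : Prop :=
  (v.1.1 = u.1.1 + 1 ∧ v.1.2 - u.1.2 ≤ 1 ∧ u.1.2 - v.1.2 ≤ 1) ∨
    (u.1.1 % 4 = 1 ∧ v.1.1 = u.1.1 ∧ u.1.2 = -1 ∧ v.1.2 = 1)

/-- The strip: a triangle and a chain of octagons with a chord, glued at cut vertices. -/
def strip (n : ℕ) : SimpleGraph (Site n) where
  Adj u v := Arrow u v ∨ Arrow v u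
  symm := ⟨fun _ _ h => h.symm⟩
  loopless := ⟨fun u h => by simp only [Arrow] at h; omega⟩

lemma ext_iff {u v : Site n} : u = v ↔ u.1.1 = v.1.1 ∧ u.1.2 = v.1.2 := by
  rw [Subtype.ext_iff, Prod.ext_iff]

lemma exists_coords {k s : ℤ} (h : IsSite n (k, s)) : ∃ u : Site n, u.1.1 = k ∧ u.1.2 = s :=
  ⟨⟨(k, s), h⟩, rfl, rfl⟩

/-! ### The straight-line drawing -/

/-- The position of a vertex in the plane. -/
def point (u : Site n) : ℝ × ℝ := (u.1.1, u.1.2)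

/-- The straight arc from `u` to `v`. -/
def line (u v : Site n) (t : ℝ) : ℝ × ℝ :=
  (u.1.1 + t * (v.1.1 - u.1.1), u.1.2 + t * (v.1.2 - u.1.2))

lemma point_injective : Function.Injective (point (n := n)) := by
  intro u v h
  simp only [point, Prod.mk.injEq, Int.cast_inj] at h
  exact ext_iff.2 h

lemma line_zero (u v : Site n) : line u v 0 = point u := by simp [line, point]

lemma line_one (u v : Site n) : line u v 1 = point v := by simp [line, point]

lemma image_line_subset (u v : Site n) :
    line v u '' Set.Icc 0 1 ⊆ line u v '' Set.Icc 0 1 := by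
  rintro _ ⟨t, ht, rfl⟩
  refine ⟨1 - t, ⟨by linarith [ht.2], by linarith [ht.1]⟩, ?_⟩
  simp only [line, Prod.mk.injEq]
  constructor <;> ring

lemma image_line_comm (u v : Site n) :
    line v u '' Set.Icc 0 1 = line u v '' Set.Icc 0 1 :=
  (image_line_subset u v).antisymm (image_line_subset v u)

lemma line_injective {u v : Site n} (h : u ≠ v) : Function.Injective (line u v) := by
  intro s t hst
  simp only [line, Prod.mk.injEq, add_right_inj] at hst
  by_contra hne
  refine h (point_injective ?_)
  have key : ∀ a b : ℝ, s * (b - a) = t * (b - a) → a = b := fun a b hab => by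
    rcases mul_eq_mul_right_iff.1 hab with h' | h'
    · exact absurd h' hne
    · linarith
  exact Prod.ext (key _ _ hst.1) (key _ _ hst.2)

/-- A point of an edge that lies in an integer column is a vertex of the edge or lies on a rung. -/
lemma Arrow.eq_point_of_fst_eq {u v : Site n} (h : Arrow u v) {t : ℝ} (ht : t ∈ Set.Icc (0 : ℝ) 1)
    {k : ℤ} (hk : (line u v t).1 = k) :
    (k = u.1.1 ∧ line u v t = point u) ∨ (k = v.1.1 ∧ line u v t = point v) ∨
      (k = u.1.1 ∧ k % 4 = 1 ∧ v.1.1 = u.1.1 ∧ u.1.2 = -1 ∧ v.1.2 = 1 ∧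
        line u v t = ((u.1.1 : ℝ), 2 * t - 1)) := by
  rcases h with ⟨h₁, -, -⟩ | ⟨h₁, h₂, h₃, h₄⟩
  · have hk' : (u.1.1 : ℝ) + t = k := by
      rw [← hk]; simp [line, h₁]
    have h₀ : u.1.1 ≤ k := by
      exact_mod_cast (by linarith [ht.1] : (u.1.1 : ℝ) ≤ k)
    have h₂ : k ≤ u.1.1 + 1 := by
      exact_mod_cast (by linarith [ht.2] : (k : ℝ) ≤ u.1.1 + 1)
    obtain rfl | rfl : k = u.1.1 ∨ k = u.1.1 + 1 := by omega
    · obtain rfl : t = 0 := by linarith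
      exact .inl ⟨rfl, line_zero u v⟩
    · obtain rfl : t = 1 := by push_cast at hk'; linarith
      exact .inr (.inl ⟨h₁.symm, line_one u v⟩)
  · have hk' : k = u.1.1 := by
      have : (k : ℝ) = u.1.1 := by rw [← hk]; simp [line, h₂]
      exact_mod_cast this
    refine .inr (.inr ⟨hk', by omega, h₂, h₃, h₄, ?_⟩)
    simp only [line, h₂, h₃, h₄, Prod.mk.injEq]
    push_cast
    constructor <;> ring

lemma Arrow.fst_line_mem {u v : Site n} (h : Arrow u v) {t : ℝ} (ht : t ∈ Set.Icc (0 : ℝ) 1) :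
    (u.1.1 : ℝ) ≤ (line u v t).1 ∧ (line u v t).1 ≤ v.1.1 ∧ v.1.1 ≤ u.1.1 + 1 := by
  rcases h with ⟨h₁, -, -⟩ | ⟨h₁, h₂, h₃, h₄⟩
  · refine ⟨?_, ?_, by omega⟩ <;> simp [line, h₁, ht.1, ht.2]
  · refine ⟨?_, ?_, by omega⟩ <;> simp [line, h₂]

/-- A point of the drawing in the column of a vertex is at most as far from the axis. -/
lemma Arrow.abs_snd_le {u v : Site n} (h : Arrow u v) {t : ℝ} (ht : t ∈ Set.Icc (0 : ℝ) 1)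
    {w : Site n} (hw : (line u v t).1 = w.1.1) : |(line u v t).2| ≤ |(w.1.2 : ℝ)| := by
  have aux : ∀ a : Site n, w.1.1 = a.1.1 → |((point a).2 : ℝ)| ≤ |(w.1.2 : ℝ)| := fun a ha => by
    have h₁ := a.2
    have h₂ := w.2
    simp only [IsSite] at h₁ h₂
    obtain h | h : a.1.2 = w.1.2 ∨ a.1.2 = -w.1.2 := by omega
    · simp [point, h]
    · simp [point, h]
  rcases h.eq_point_of_fst_eq ht hw with ⟨h₁, h₂⟩ | ⟨h₁, h₂⟩ | ⟨h₁, h₂, h₃, h₄, h₅, h₆⟩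
  · rw [h₂]; exact aux u h₁
  · rw [h₂]; exact aux v h₁
  · refine le_trans ?_ (aux u h₁)
    rw [h₆]
    simp only [point, h₄]
    rw [abs_le]
    push_cast
    rw [abs_neg, abs_one]
    constructor <;> linarith [ht.1, ht.2]

lemma Arrow.eq_or_eq_of_point_eq {u v w : Site n} (h : Arrow u v) {t : ℝ}
    (ht : t ∈ Set.Icc (0 : ℝ) 1) (hw : line u v t = point w) : w = u ∨ w = v := by
  rcases h.eq_point_of_fst_eq ht (k := w.1.1) (by rw [hw]; rfl) with
    ⟨-, h₂⟩ | ⟨-, h₂⟩ | ⟨h₁, h₂, h₃, h₄, h₅, -⟩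
  · exact .inl (point_injective (hw.symm.trans h₂))
  · exact .inr (point_injective (hw.symm.trans h₂))
  · have := w.2
    simp only [IsSite] at this
    rw [ext_iff, ext_iff]
    omega

/-- A common point of two distinct edges is a common vertex of both. -/
lemma Arrow.exists_vertex {u v x y : Site n} (h₁ : Arrow u v) (h₂ : Arrow x y) {s t : ℝ}
    (hs : s ∈ Set.Icc (0 : ℝ) 1) (ht : t ∈ Set.Icc (0 : ℝ) 1) (hst : line u v s = line x y t)
    (hne : ¬ (u = x ∧ v = y)) :
    ∃ w, (w = u ∨ w = v) ∧ (w = x ∨ w = y) ∧ point w = line u v s := by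
  have of_point : ∀ w, line u v s = point w →
      ∃ w, (w = u ∨ w = v) ∧ (w = x ∨ w = y) ∧ point w = line u v s := fun w hw =>
    ⟨w, h₁.eq_or_eq_of_point_eq hs hw, h₂.eq_or_eq_of_point_eq ht (hst ▸ hw), hw.symm⟩
  have of_column : ∀ k : ℤ, (line u v s).1 = k →
      ∃ w, (w = u ∨ w = v) ∧ (w = x ∨ w = y) ∧ point w = line u v s := fun k hk => by
    rcases h₁.eq_point_of_fst_eq hs hk with ⟨-, h⟩ | ⟨-, h⟩ | ⟨a₁, a₂, a₃, a₄, a₅, -⟩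
    · exact of_point _ h
    · exact of_point _ h
    rcases h₂.eq_point_of_fst_eq ht (hst ▸ hk) with ⟨-, h⟩ | ⟨-, h⟩ | ⟨b₁, b₂, b₃, b₄, b₅, -⟩
    · exact of_point _ (hst.trans h)
    · exact of_point _ (hst.trans h)
    refine absurd ?_ hne
    rw [ext_iff, ext_iff]
    omega
  obtain ⟨l₁, r₁, d₁⟩ := h₁.fst_line_mem hs
  obtain ⟨l₂, r₂, d₂⟩ := h₂.fst_line_mem ht
  rw [← hst] at l₂ r₂
  have c₁ : u.1.1 ≤ y.1.1 := by exact_mod_cast l₁.trans r₂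
  have c₂ : x.1.1 ≤ v.1.1 := by exact_mod_cast l₂.trans r₁
  rcases lt_trichotomy u.1.1 x.1.1 with hlt | heq | hgt
  · exact of_column v.1.1 (le_antisymm r₁ (le_trans (by exact_mod_cast (by omega)) l₂))
  · rcases h₁ with ⟨a₁, a₂, a₃⟩ | ⟨a₁, a₂, a₃, a₄⟩
    · rcases h₂ with ⟨b₁, b₂, b₃⟩ | ⟨b₁, b₂, b₃, b₄⟩
      · have e₁ := congrArg Prod.fst hst
        have e₂ := congrArg Prod.snd hst
        simp only [line, a₁, b₁, heq] at e₁ e₂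
        obtain rfl : s = t := by push_cast at e₁; linarith
        have hu := u.2
        have hv := v.2
        have hx := x.2
        have hy := y.2
        simp only [IsSite] at hu hv hx hy
        by_cases hux : u = x
        · have hvy : v.1.2 - y.1.2 ≠ 0 := fun h => hne ⟨hux, ext_iff.2 (by omega)⟩
          subst hux
          have : s * ((v.1.2 - y.1.2 : ℤ) : ℝ) = 0 := by push_cast; linarith
          obtain rfl : s = 0 := by
            rcases mul_eq_zero.1 this with h | h
            · exact h
            · exact absurd (by exact_mod_cast h) hvy
          exact of_point u (line_zero u v)
        · rw [ext_iff] at hux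
          by_cases hvy : v = y
          · subst hvy
            have hux' : u.1.2 - x.1.2 ≠ 0 := by omega
            have : (1 - s) * ((u.1.2 - x.1.2 : ℤ) : ℝ) = 0 := by push_cast; linarith
            obtain rfl : s = 1 := by
              rcases mul_eq_zero.1 this with h | h
              · linarith
              · exact absurd (by exact_mod_cast h) hux'
            exact of_point v (line_one u v)
          · rw [ext_iff] at hvy
            have f₁ : v.1.2 = u.1.2 := by omega
            have f₂ : y.1.2 = x.1.2 := by omega
            have : (u.1.2 : ℝ) = x.1.2 := by simpa [f₁, f₂] using e₂
            have : u.1.2 = x.1.2 := by exact_mod_cast this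
            omega
      · exact of_column x.1.1 (le_antisymm (by rwa [b₂] at r₂) l₂)
    · exact of_column u.1.1 (le_antisymm (by rwa [a₂] at r₁) l₁)
  · exact of_column u.1.1 (le_antisymm (le_trans r₂ (by exact_mod_cast (by omega))) l₁)

/-- Every edge is an arrow up to reversal. -/
lemma exists_arrow {u v : Site n} (h : (strip n).Adj u v) :
    ∃ a b, Arrow a b ∧ ({u, v} : Set (Site n)) = {a, b} ∧ s(u, v) = s(a, b) ∧
      line u v '' Set.Icc 0 1 = line a b '' Set.Icc 0 1 := by
  rcases h with h | h
  · exact ⟨u, v, h, rfl, rfl, rfl⟩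
  · exact ⟨v, u, h, Set.pair_comm u v, Sym2.eq_swap, image_line_comm v u⟩

/-- The straight-line plane embedding of the strip. -/
def embedding (n : ℕ) : PlaneEmbedding (strip n) where
  pos := point
  pos_inj := point_injective
  arc u v _ := line u v
  arc_continuousOn u v _ := by unfold line; fun_prop
  arc_injOn u v h := (line_injective h.ne).injOn
  arc_zero u v _ := line_zero u v
  arc_one u v _ := line_one u v
  arc_symm u v _ := image_line_comm u v
  arc_inter u v x y h₁ h₂ hne := by
    obtain ⟨a, b, hab, e₁, e₂, e₃⟩ := exists_arrow h₁
    obtain ⟨c, d, hcd, f₁, f₂, f₃⟩ := exists_arrow h₂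
    rw [e₁, f₁, e₃, f₃]
    rintro _ ⟨⟨s, hs, rfl⟩, t, ht, hst⟩
    obtain ⟨w, hw₁, hw₂, hw⟩ := hab.exists_vertex hcd hs ht hst.symm (by
      rintro ⟨rfl, rfl⟩
      exact hne (e₂.trans f₂.symm))
    exact ⟨w, ⟨hw₁, hw₂⟩, hw⟩
  arc_vertex u v h w hw := by
    obtain ⟨a, b, hab, e₁, -, e₃⟩ := exists_arrow h
    rw [e₃] at hw
    obtain ⟨t, ht, hw⟩ := hw
    have : w ∈ ({a, b} : Set (Site n)) := hab.eq_or_eq_of_point_eq ht hw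
    rwa [← e₁] at this

lemma abs_snd_le_of_mem_drawing {z : ℝ × ℝ} (hz : z ∈ (embedding n).drawing) {w : Site n}
    (hw : z.1 = w.1.1) : |z.2| ≤ |(w.1.2 : ℝ)| := by
  rcases hz with ⟨v, rfl⟩ | hz
  · simp only [embedding, point] at hw ⊢
    have h₁ := v.2
    have h₂ := w.2
    simp only [IsSite] at h₁ h₂
    norm_cast at hw
    obtain h | h : v.1.2 = w.1.2 ∨ v.1.2 = -w.1.2 := by omega
    · simp [h]
    · simp [h]
  · simp only [Set.mem_iUnion] at hz
    obtain ⟨u, v, h, hz⟩ := hz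
    obtain ⟨a, b, hab, -, -, e⟩ := exists_arrow h
    have hz' : z ∈ line a b '' Set.Icc 0 1 := e ▸ hz
    obtain ⟨t, ht, rfl⟩ := hz'
    exact hab.abs_snd_le ht hw

/-- Every vertex of the strip sees infinity along a vertical ray. -/
lemma outerVertex (w : Site n) : (embedding n).OuterVertex w := by
  obtain ⟨σ, hσ, hray⟩ : ∃ σ : ℝ, |σ| = 1 ∧ ∀ t : ℝ, 0 < t →
      |(w.1.2 : ℝ)| + t ≤ |(w.1.2 : ℝ) + σ * t| := by
    rcases le_total 0 (w.1.2 : ℝ) with h | h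
    · refine ⟨1, abs_one, fun t ht => ?_⟩
      rw [abs_of_nonneg h, one_mul]
      exact le_abs_self _
    · refine ⟨-1, by simp, fun t ht => ?_⟩
      rw [abs_of_nonpos h]
      exact le_trans (by linarith) (neg_le_abs _)
  set ray : ℝ → ℝ × ℝ := fun t => (w.1.1, w.1.2 + σ * t) with hray_def
  have hcont : Continuous ray := by fun_prop
  have hsub : ray '' Set.Ioi 0 ⊆ (embedding n).drawingᶜ := by
    rintro _ ⟨t, ht, rfl⟩ hmem
    have h₁ := abs_snd_le_of_mem_drawing hmem (w := w) rfl
    have h₂ := hray t ht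
    have h₃ : (0 : ℝ) < t := ht
    simp only [hray_def] at h₁
    linarith
  have hconn : IsPreconnected (ray '' Set.Ioi 0) :=
    isPreconnected_Ioi.image _ hcont.continuousOn
  have hunb : ¬ Bornology.IsBounded (ray '' Set.Ioi 0) := by
    intro hb
    obtain ⟨R, hR⟩ := hb.exists_norm_le
    have h₁ := hR _ ⟨|R| + 1, by simp only [Set.mem_Ioi]; positivity, rfl⟩
    have h₂ := hray (|R| + 1) (by positivity)
    have h₃ := (norm_snd_le (ray (|R| + 1))).trans h₁
    simp only [hray_def, Real.norm_eq_abs] at h₃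
    linarith [le_abs_self R, abs_nonneg (w.1.2 : ℝ)]
  have hface : ∀ t ∈ Set.Ioi (0 : ℝ), ray t ∈ (embedding n).outerFace := fun t ht =>
    ⟨hsub ⟨t, ht, rfl⟩, fun hb => hunb (hb.subset
      (hconn.subset_connectedComponentIn ⟨t, ht, rfl⟩ hsub))⟩
  have hlim : Filter.Tendsto ray (nhdsWithin 0 (Set.Ioi 0)) (nhds ((embedding n).pos w)) := by
    have h₀ : (embedding n).pos w = ray 0 := by simp [hray_def, embedding, point]
    rw [h₀]
    exact hcont.continuousAt.tendsto.mono_left nhdsWithin_le_nhds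
  exact mem_closure_of_tendsto hlim (eventually_mem_nhdsWithin.mono hface)

/-! ### Short cycles -/

lemma adj_iff {u v : Site n} : (strip n).Adj u v ↔ Arrow u v ∨ Arrow v u := Iff.rfl

/-- The vertex at the left end of the strip. -/
def tip (n : ℕ) : Site n := ⟨(0, 0), by dsimp only [IsSite]; omega⟩

/-- The upper neighbour of the tip. -/
def upper (n : ℕ) : Site n := ⟨(1, 1), by dsimp only [IsSite]; omega⟩

/-- The lower neighbour of the tip. -/
def lower (n : ℕ) : Site n := ⟨(1, -1), by dsimp only [IsSite]; omega⟩

/-- The cut vertex at the right end of block `i`. -/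
def joint (n i : ℕ) (hi : i ≤ n) : Site n :=
  ⟨(4 * i + 3, 0), by dsimp only [IsSite]; omega⟩

lemma adj_tip_upper : (strip n).Adj (tip n) (upper n) := by simp [adj_iff, Arrow, tip, upper]

lemma adj_upper_lower : (strip n).Adj (upper n) (lower n) := by simp [adj_iff, Arrow, lower, upper]

lemma adj_lower_tip : (strip n).Adj (lower n) (tip n) := by simp [adj_iff, Arrow, tip, lower]

lemma fst_le_one_of_triangle {u v w : Site n} (h₁ : (strip n).Adj u v) (h₂ : (strip n).Adj v w)
    (h₃ : (strip n).Adj w u) : u.1.1 ≤ 1 := by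
  have hu := u.2
  have hv := v.2
  have hw := w.2
  simp only [IsSite, adj_iff, Arrow] at *
  omega

lemma not_square {u v w x : Site n} (h₁ : (strip n).Adj u v) (h₂ : (strip n).Adj v w)
    (h₃ : (strip n).Adj w x) (h₄ : (strip n).Adj x u) (huw : u ≠ w) (hvx : v ≠ x) : False := by
  have hu := u.2
  have hv := v.2
  have hw := w.2
  have hx := x.2
  simp only [IsSite, adj_iff, Arrow, ne_eq, ext_iff] at *
  omega

lemma eq_of_fst_le_one {u : Site n} (h : u.1.1 ≤ 1) : u = tip n ∨ u = upper n ∨ u = lower n := by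
  have hu := u.2
  simp only [ext_iff]
  dsimp only [IsSite, tip, upper, lower] at *
  omega

/-- A cycle of length at most four runs around the triangle at the tip. -/
lemma short_cycle {a : Site n} (c : (strip n).Walk a a) (hc : c.IsCycle) (hlen : c.length ≤ 4) :
    (∀ y ∈ c.support, y.1.1 ≤ 1) ∧ ∀ e, e ∈ c.edges ↔
      e = s(tip n, upper n) ∨ e = s(upper n, lower n) ∨ e = s(lower n, tip n) := by
  have hthree := hc.three_le_length
  have hnodup := hc.support_nodup
  match c with
  | .nil => simp at hthree
  | .cons _ .nil => simp at hthree
  | .cons _ (.cons _ .nil) => simp at hthree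
  | .cons (v := v) h₁ (.cons (v := w) h₂ (.cons h₃ .nil)) =>
    have ha := fst_le_one_of_triangle h₁ h₂ h₃
    have hv := fst_le_one_of_triangle h₂ h₃ h₁
    have hw := fst_le_one_of_triangle h₃ h₁ h₂
    refine ⟨by simp [ha, hv, hw], fun e => ?_⟩
    have n₁ := h₁.ne
    have n₂ := h₂.ne
    have n₃ := h₃.ne
    simp only [Walk.edges_cons, Walk.edges_nil, List.mem_cons, List.not_mem_nil, or_false]
    rcases eq_of_fst_le_one ha with rfl | rfl | rfl <;>
      rcases eq_of_fst_le_one hv with rfl | rfl | rfl <;>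
      rcases eq_of_fst_le_one hw with rfl | rfl | rfl <;>
      grind
  | .cons h₁ (.cons h₂ (.cons h₃ (.cons h₄ .nil))) =>
    simp only [Walk.support_cons, Walk.support_nil, List.tail_cons, List.nodup_cons,
      List.mem_cons, List.not_mem_nil, not_or, or_false] at hnodup
    exact (not_square h₁ h₂ h₃ h₄ (Ne.symm hnodup.2.1.2) hnodup.1.2.1).elim
  | .cons _ (.cons _ (.cons _ (.cons _ (.cons _ _)))) =>
    simp only [Walk.length_cons] at hlen
    omega

lemma exists_short_cycle (n : ℕ) :
    ∃ (a : Site n) (c : (strip n).Walk a a), c.IsCycle ∧ c.length ≤ 4 := by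
  refine ⟨tip n, .cons adj_tip_upper (.cons adj_upper_lower (.cons adj_lower_tip .nil)), ?_, ?_⟩
  · have n₁ := (adj_tip_upper (n := n)).ne
    have n₂ := (adj_upper_lower (n := n)).ne
    have n₃ := (adj_lower_tip (n := n)).ne
    simp [Walk.cons_isCycle_iff, Walk.cons_isPath_iff, n₁, n₁.symm, n₂, n₃, n₃.symm]
  · simp

/-- A walk advances by at most one column per step. -/
lemma fst_le_length {u v : Site n} (p : (strip n).Walk u v) : u.1.1 ≤ v.1.1 + p.length := by
  induction p with
  | nil => simp
  | cons h p ih =>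
    simp only [adj_iff, Arrow] at h
    rw [Walk.length_cons]
    push_cast
    omega

/-! ### Lists -/

/-- The lists on the strip: a column is treated according to its residue modulo `4`, except that
the last vertex is precolored. -/
def palette (n : ℕ) (u : Site n) : Finset ℕ :=
  if u.1.1 = 4 * n + 3 then {0}
  else if u.1.1 % 4 = 0 then {1, 2}
  else if u.1.1 % 4 = 1 then {1, 2, 3}
  else if u.1.1 % 4 = 2 then {0, 3}
  else {0, 1, 2}

lemma card_palette (u : Site n) : (palette n u).card =
    if u.1.1 = 4 * n + 3 then 1 else if u.1.1 % 4 = 0 ∨ u.1.1 % 4 = 2 then 2 else 3 := by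
  unfold palette
  split_ifs <;> first | rfl | omega

/-- If the vertices in column `4 * i` carry the same color, then the cut vertex of block `i`
cannot be colored `0`. -/
lemma color_joint_ne_zero_of_eq {φ : Site n → ℕ} (hφ : IsLColoring (strip n) (palette n) φ)
    {i : ℕ} (hi : i ≤ n)
    (h : ∃ p q : Site n, p.1.1 = 4 * i ∧ q.1.1 = 4 * i ∧ 0 ≤ p.1.2 ∧ q.1.2 ≤ 0 ∧ φ p = φ q) :
    φ (joint n i hi) ≠ 0 := by
  obtain ⟨p, q, hp, hq, hp', hq', hpq⟩ := h
  intro h₀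
  obtain ⟨z₁, z₁_fst, z₁_snd⟩ := exists_coords (n := n) (k := 4 * i + 1) (s := 1)
    (by dsimp only [IsSite]; omega)
  obtain ⟨z₂, z₂_fst, z₂_snd⟩ := exists_coords (n := n) (k := 4 * i + 1) (s := -1)
    (by dsimp only [IsSite]; omega)
  obtain ⟨y₁, y₁_fst, y₁_snd⟩ := exists_coords (n := n) (k := 4 * i + 2) (s := 1)
    (by dsimp only [IsSite]; omega)
  obtain ⟨y₂, y₂_fst, y₂_snd⟩ := exists_coords (n := n) (k := 4 * i + 2) (s := -1)
    (by dsimp only [IsSite]; omega)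
  have hj : (joint n i hi).1.1 = 4 * i + 3 ∧ (joint n i hi).1.2 = 0 := ⟨rfl, rfl⟩
  have sp := p.2
  have sq := q.2
  simp only [IsSite] at sp sq
  have e₁ := hφ.2 (u := p) (v := z₁) (by simp only [adj_iff, Arrow]; omega)
  have e₂ := hφ.2 (u := q) (v := z₂) (by simp only [adj_iff, Arrow]; omega)
  have e₃ := hφ.2 (u := z₁) (v := y₁) (by simp only [adj_iff, Arrow]; omega)
  have e₄ := hφ.2 (u := z₂) (v := y₂) (by simp only [adj_iff, Arrow]; omega)
  have e₅ := hφ.2 (u := z₂) (v := z₁) (by simp only [adj_iff, Arrow]; omega)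
  have e₆ := hφ.2 (u := y₁) (v := joint n i hi) (by simp only [adj_iff, Arrow]; omega)
  have e₇ := hφ.2 (u := y₂) (v := joint n i hi) (by simp only [adj_iff, Arrow]; omega)
  have l₁ : φ p = 1 ∨ φ p = 2 := by
    have := hφ.1 p
    rwa [palette, if_neg (by omega), if_pos (by omega), Finset.mem_insert,
      Finset.mem_singleton] at this
  have l₂ : ∀ z : Site n, z.1.1 = 4 * i + 1 → φ z = 1 ∨ φ z = 2 ∨ φ z = 3 := fun z hz => by
    have := hφ.1 z
    rwa [palette, if_neg (by omega), if_neg (by omega), if_pos (by omega), Finset.mem_insert,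
      Finset.mem_insert, Finset.mem_singleton] at this
  have l₃ : ∀ y : Site n, y.1.1 = 4 * i + 2 → φ y = 0 ∨ φ y = 3 := fun y hy => by
    have := hφ.1 y
    rwa [palette, if_neg (by omega), if_neg (by omega), if_neg (by omega), if_pos (by omega),
      Finset.mem_insert, Finset.mem_singleton] at this
  have := l₂ z₁ z₁_fst
  have := l₂ z₂ z₂_fst
  have := l₃ y₁ y₁_fst
  have := l₃ y₂ y₂_fst
  omega

lemma color_joint_ne_zero {φ : Site n → ℕ} (hφ : IsLColoring (strip n) (palette n) φ) (i : ℕ)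
    (hi : i ≤ n) : φ (joint n i hi) ≠ 0 := by
  induction i with
  | zero => exact color_joint_ne_zero_of_eq hφ hi ⟨tip n, tip n, rfl, rfl, le_rfl, le_rfl, rfl⟩
  | succ i ih =>
    have ih := ih (by omega)
    obtain ⟨u₁, u₁_fst, u₁_snd⟩ := exists_coords (n := n) (k := 4 * i + 4) (s := 1)
      (by dsimp only [IsSite]; omega)
    obtain ⟨u₂, u₂_fst, u₂_snd⟩ := exists_coords (n := n) (k := 4 * i + 4) (s := -1)
      (by dsimp only [IsSite]; omega)
    have hj : (joint n i (by omega)).1.1 = 4 * i + 3 ∧ (joint n i (by omega)).1.2 = 0 := ⟨rfl, rfl⟩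
    have e₁ := hφ.2 (u := joint n i (by omega)) (v := u₁)
      (by simp only [adj_iff, Arrow]; omega)
    have e₂ := hφ.2 (u := joint n i (by omega)) (v := u₂)
      (by simp only [adj_iff, Arrow]; omega)
    have l₁ : ∀ u : Site n, u.1.1 = 4 * i + 4 → φ u = 1 ∨ φ u = 2 := fun u hu => by
      have := hφ.1 u
      rwa [palette, if_neg (by omega), if_pos (by omega), Finset.mem_insert,
        Finset.mem_singleton] at this
    have l₂ : φ (joint n i (by omega)) = 0 ∨ φ (joint n i (by omega)) = 1 ∨
        φ (joint n i (by omega)) = 2 := by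
      have := hφ.1 (joint n i (by omega))
      rwa [palette, if_neg (by omega), if_neg (by omega),
        if_neg (by omega), if_neg (by omega),
        Finset.mem_insert, Finset.mem_insert, Finset.mem_singleton] at this
    have := l₁ u₁ u₁_fst
    have := l₁ u₂ u₂_fst
    refine color_joint_ne_zero_of_eq hφ hi ⟨u₁, u₂, ?_, ?_, ?_, ?_, by omega⟩ <;>
      push_cast <;> omega

lemma not_lColorable (n : ℕ) : ¬ LColorable (strip n) (palette n) := by
  rintro ⟨φ, hφ⟩
  refine color_joint_ne_zero hφ n le_rfl ?_
  have := hφ.1 (joint n n le_rfl)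
  rwa [palette, if_pos (by simp [joint]), Finset.mem_singleton] at this

end Site

/-- The failure of hypothesis (T) cannot be remedied near the precolored vertex:
for every `d` there is a plane graph `G` with a precolored vertex `x` on the
outer face (singleton list), lists of size `3` on interior vertices and of size
`2` or `3` on the other outer vertices, with the size-two-list vertices
independent, such that `G` contains exactly one cycle of length at most `4`
(any two such cycles have the same edge set), this cycle is at distance at
least `d` from `x`, and `G` is not `L`-colorable. -/
theorem hypothesis_T_necessary_far_from_precolored_vertex (d : ℕ) :
    ∃ (V : Type) (_ : Fintype V) (_ : DecidableEq V) (G : SimpleGraph V)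
      (emb : PlaneEmbedding G) (x : V) (L : V → Finset ℕ),
      emb.OuterVertex x ∧
      (L x).card = 1 ∧
      (∀ v, ¬ emb.OuterVertex v → (L v).card = 3) ∧
      (∀ v, emb.OuterVertex v → v ≠ x → 2 ≤ (L v).card ∧ (L v).card ≤ 3) ∧
      (∀ u v, (L u).card = 2 → (L v).card = 2 → ¬ G.Adj u v) ∧
      (∃ (a : V) (c : G.Walk a a), c.IsCycle ∧ c.length ≤ 4) ∧
      (∀ ⦃a b : V⦄ (c₁ : G.Walk a a) (c₂ : G.Walk b b),
        c₁.IsCycle → c₂.IsCycle → c₁.length ≤ 4 → c₂.length ≤ 4 →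
        ∀ e : Sym2 V, e ∈ c₁.edges ↔ e ∈ c₂.edges) ∧
      (∀ (a : V) (c : G.Walk a a), c.IsCycle → c.length ≤ 4 →
        ∀ y ∈ c.support, ∀ q : G.Walk x y, d ≤ q.length) ∧
      ¬ LColorable G L := by
  open Site in
  refine ⟨Site d, Fintype.ofFinite _, inferInstance, strip d, embedding d, joint d d le_rfl,
    palette d, outerVertex _, ?_, fun v hv => absurd (outerVertex v) hv, ?_, ?_,
    exists_short_cycle d, ?_, ?_, not_lColorable d⟩
  · simp [card_palette, joint]
  · intro v _ hv
    have hs := v.2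
    simp only [IsSite] at hs
    have : v.1.1 ≠ 4 * d + 3 := fun h => hv (ext_iff.2 (by simp only [joint]; omega))
    rw [card_palette, if_neg this]
    split_ifs <;> simp
  · intro u v hu hv h
    have su := u.2
    have sv := v.2
    rw [card_palette] at hu hv
    simp only [IsSite, adj_iff, Arrow] at *
    split_ifs at hu hv <;> omega
  · intro a b c₁ c₂ h₁ h₂ l₁ l₂ e
    rw [(short_cycle c₁ h₁ l₁).2, (short_cycle c₂ h₂ l₂).2]
  · intro a c hc hl y hy q
    have h₁ := (short_cycle c hc hl).1 y hy
    have h₂ := fst_le_length q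
    have h₃ : (joint d d le_rfl).1.1 = 4 * d + 3 := rfl
    omega
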